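/- arXiv:2411.01161 — 9 statements merged into one kernel-verified Lean document; each statement's English description precedes it below -/
import Mathlib

section
/- Let Λ ⊂ {λ ∈ ℝ^n : ∑_{i=1}^n λ_i = 1} be a nonempty compact set, and let m, M ∈ ℝ with M ≥ m. Then the minimum of ∑_{i=1}^n λ_i x_i over all λ ∈ Λ and all x ∈ [m, M]^n exists and equals m − ((M − m)/2)·(‖Λ‖₁ − 1). -/
/-- For a nonempty compact `Λ` contained in the hyperplane `{∑ λ_i = 1}`,
with `N = ‖Λ‖₁`, and `m ≤ M`, the minimum of `∑ λ_i x_i` over `λ ∈ Λ` and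
`x ∈ [m, M]^n` exists and equals `m − ((M − m)/2)·(N − 1)`. -/
theorem stmt_3 (n : ℕ) (Λ : Set (Fin n → ℝ))
    (hΛne : Λ.Nonempty) (hΛc : IsCompact Λ)
    (hΛ1 : ∀ l ∈ Λ, ∑ i, l i = 1)
    (m M : ℝ) (hmM : m ≤ M)
    (N : ℝ) (hN : IsGreatest {s : ℝ | ∃ c ∈ Λ, s = ∑ i, |c i|} N) :
    IsLeast
      {s : ℝ | ∃ l ∈ Λ, ∃ x : Fin n → ℝ, (∀ i, m ≤ x i ∧ x i ≤ M) ∧ s = ∑ i, l i * x i}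
      (m - (M - m) / 2 * (N - 1)) := by
  have sum_eq : ∀ l ∈ Λ, ∑ i, (l i * ((m + M) / 2) - |l i| * ((M - m) / 2))
      = m - (M - m) / 2 * (∑ i, |l i| - 1) := by
    intro l hl
    rw [Finset.sum_sub_distrib, ← Finset.sum_mul, ← Finset.sum_mul, hΛ1 l hl]
    ring
  constructor
  · obtain ⟨c, hc, rfl⟩ := hN.1
    refine ⟨c, hc, fun i => if 0 ≤ c i then m else M, fun i => ?_, ?_⟩
    · dsimp only
      split_ifs <;> simp [hmM]
    · rw [← sum_eq c hc]
      refine Finset.sum_congr rfl fun i _ => ?_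
      dsimp only
      split_ifs with h
      · rw [abs_of_nonneg h]
        ring
      · rw [abs_of_neg (not_le.mp h)]
        ring
  · rintro s ⟨l, hl, x, hx, rfl⟩
    calc m - (M - m) / 2 * (N - 1) ≤ m - (M - m) / 2 * (∑ i, |l i| - 1) := by
          have hlN : ∑ i, |l i| ≤ N := hN.2 ⟨l, hl, rfl⟩
          have hd : 0 ≤ (M - m) / 2 := by linarith
          gcongr
      _ = ∑ i, (l i * ((m + M) / 2) - |l i| * ((M - m) / 2)) := (sum_eq l hl).symm
      _ ≤ ∑ i, l i * x i := by
          refine Finset.sum_le_sum fun i _ => ?_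
          obtain ⟨hm, hM⟩ := hx i
          rcases abs_cases (l i) with ⟨h, h0⟩ | ⟨h, h0⟩ <;> rw [h] <;> nlinarith
end

section
/- Let Θ ⊂ ℝ^d have nonempty interior, let A, B ⊆ Δ^{n−1} be nonempty compact, and let f_1,…,f_n : Θ → [0,∞) be continuous on Θ and continuously differentiable on the interior of Θ. Let 0 ≤ φ < φ̃ and suppose (θ*, a*, b*) ∈ Θ × A × B with θ* in the interior of Θ satisfies both: for all θ ∈ Θ, ∑_i a*_i f_i(θ*) − φ ∑_i b*_i f_i(θ*) ≤ ∑_i a*_i f_i(θ) − φ ∑_i b*_i f_i(θ), and for all θ ∈ Θ, ∑_i a*_i f_i(θ*) − φ̃ ∑_i b*_i f_i(θ*) ≤ ∑_i a*_i f_i(θ) − φ̃ ∑_i b*_i f_i(θ) (i.e., θ* is simultaneously a minimizer of the φ-objective and the φ̃-objective with weights (a*, b*)). Then ∑_{i=1}^n b*_i ∇f_i(θ*) = 0 and ∑_{i=1}^n a*_i ∇f_i(θ*) = 0. Consequently, if at least one of these two gradient sums is nonzero, no solution tuple of the φ-problem can also solve the φ̃-problem. -/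
/-- First-order optimality for a difference of weighted sums: at an interior minimizer of
`∑ a_i f_i - c ∑ b_i f_i`, the derivatives satisfy `∑ a_i f_i' = c ∑ b_i f_i'`. -/
theorem sum_smul_fderiv_eq_of_isMinOn {ι E : Type*} [Fintype ι] [NormedAddCommGroup E]
    [NormedSpace ℝ E] {s : Set E} {f : ι → E → ℝ} {x : E} {a b : ι → ℝ} {c : ℝ}
    (hx : x ∈ interior s) (hf : ∀ i, DifferentiableAt ℝ (f i) x)
    (hmin : IsMinOn (fun y => (∑ i, a i * f i y) - c * ∑ i, b i * f i y) s x) :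
    ∑ i, a i • fderiv ℝ (f i) x = c • ∑ i, b i • fderiv ℝ (f i) x := by
  have hsum (w : ι → ℝ) : HasFDerivAt (fun y => ∑ i, w i * f i y)
      (∑ i, w i • fderiv ℝ (f i) x) x :=
    HasFDerivAt.fun_sum fun i _ => (hf i).hasFDerivAt.const_mul (w i)
  exact sub_eq_zero.mp ((hmin.isLocalMin (mem_interior_iff_mem_nhds.mp hx)).hasFDerivAt_eq_zero
    ((hsum a).sub ((hsum b).const_mul c)))

/-- If `(θ*, a*, b*)` with `θ*` in the interior of `Θ` is simultaneously
a minimizer of the `φ`-objective and the `φ̃`-objective (`0 ≤ φ < φ̃`) with fixed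
weights `(a*, b*)`, then both weighted gradient sums vanish at `θ*`:
`∑ b*_i ∇f_i(θ*) = 0` and `∑ a*_i ∇f_i(θ*) = 0`. -/
theorem stmt_9 (d n : ℕ)
    (Θ : Set (EuclideanSpace ℝ (Fin d))) (hΘint : (interior Θ).Nonempty)
    (A B : Set (Fin n → ℝ))
    (hAne : A.Nonempty) (hAc : IsCompact A)
    (hBne : B.Nonempty) (hBc : IsCompact B)
    (hA : ∀ a ∈ A, (∀ i, 0 ≤ a i) ∧ ∑ i, a i = 1)
    (hB : ∀ b ∈ B, (∀ i, 0 ≤ b i) ∧ ∑ i, b i = 1)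
    (f : Fin n → EuclideanSpace ℝ (Fin d) → ℝ)
    (hfc : ∀ i, ContinuousOn (f i) Θ)
    (hf0 : ∀ i, ∀ θ ∈ Θ, 0 ≤ f i θ)
    (hfd : ∀ i, ∀ θ ∈ interior Θ, DifferentiableAt ℝ (f i) θ)
    (hfd' : ∀ i, ContinuousOn (fun θ => fderiv ℝ (f i) θ) (interior Θ))
    (φ φt : ℝ) (h0 : 0 ≤ φ) (hlt : φ < φt)
    (θs : EuclideanSpace ℝ (Fin d)) (a b : Fin n → ℝ)
    (hθs : θs ∈ interior Θ) (ha : a ∈ A) (hb : b ∈ B)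
    (hsol1 : ∀ θ ∈ Θ,
      (∑ i, a i * f i θs) - φ * ∑ i, b i * f i θs ≤
        (∑ i, a i * f i θ) - φ * ∑ i, b i * f i θ)
    (hsol2 : ∀ θ ∈ Θ,
      (∑ i, a i * f i θs) - φt * ∑ i, b i * f i θs ≤
        (∑ i, a i * f i θ) - φt * ∑ i, b i * f i θ) :
    (∑ i, b i • fderiv ℝ (f i) θs) = 0 ∧ (∑ i, a i • fderiv ℝ (f i) θs) = 0 := by
  have hdiff : ∀ i, DifferentiableAt ℝ (f i) θs := fun i => hfd i θs hθs
  have h₁ := sum_smul_fderiv_eq_of_isMinOn hθs hdiff (isMinOn_iff.mpr hsol1)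
  have h₂ := sum_smul_fderiv_eq_of_isMinOn hθs hdiff (isMinOn_iff.mpr hsol2)
  have hb0 : ∑ i, b i • fderiv ℝ (f i) θs = 0 := by
    have h : (φt - φ) • ∑ i, b i • fderiv ℝ (f i) θs = 0 := by
      rw [sub_smul, ← h₁, ← h₂, sub_self]
    exact (smul_eq_zero.mp h).resolve_left (sub_pos.mpr hlt).ne'
  exact ⟨hb0, by rw [h₁, hb0, smul_zero]⟩
end

section
/- Let f_1,…,f_n : ℝ^d → ℝ be differentiable and satisfy, for constants 0 < m_f ≤ M_f and all i, x, y: (m_f/2)‖x−y‖₂² ≤ f_i(x) − f_i(y) − ⟨∇f_i(y), x−y⟩ ≤ (M_f/2)‖x−y‖₂². Let λ ∈ ℝ^n satisfy ∑_{i=1}^n λ_i = 1 and ∑_{i=1}^n |λ_i| ≤ L for some L ≥ 1. Then for all θ, θ′ ∈ ℝ^d: ∑_i λ_i f_i(θ) − ∑_i λ_i f_i(θ′) − ⟨∑_i λ_i ∇f_i(θ′), θ − θ′⟩ ≥ (1/2)·(m_f − ((M_f − m_f)/2)·(L − 1))·‖θ − θ′‖₂². In particular, if L < 1 + 2m_f/(M_f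 − m_f) (or M_f = m_f), the weighted combination θ ↦ ∑_i λ_i f_i(θ) is strongly convex even though some weights λ_i may be negative. -/
/-- A possibly negative multiple of a quantity in `[a, b]` is bounded below, with a correction
proportional to the negative part `(|c| - c) / 2` of the multiplier. -/
theorem mul_ge_of_mem_interval {a b t : ℝ} (ha : a ≤ t) (hb : t ≤ b) (c : ℝ) :
    c * a - (|c| - c) / 2 * (b - a) ≤ c * t := by
  rcases le_total 0 c with hc | hc
  · rw [abs_of_nonneg hc]
    nlinarith [mul_le_mul_of_nonneg_left ha hc]
  · rw [abs_of_nonpos hc]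
    nlinarith [mul_le_mul_of_nonpos_left hb hc]

/-- A combination with weights summing to `1` and absolute sum at most `L` of quantities in
`[a, b]` is at least `a - (L - 1) / 2 * (b - a)`. -/
theorem weighted_sum_ge_of_mem_interval {ι : Type*} {s : Finset ι} {w t : ι → ℝ} {a b L : ℝ}
    (hab : a ≤ b) (ha : ∀ i ∈ s, a ≤ t i) (hb : ∀ i ∈ s, t i ≤ b)
    (hw : ∑ i ∈ s, w i = 1) (hL : ∑ i ∈ s, |w i| ≤ L) :
    a - (L - 1) / 2 * (b - a) ≤ ∑ i ∈ s, w i * t i := by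
  calc a - (L - 1) / 2 * (b - a)
      ≤ a - ((∑ i ∈ s, |w i|) - 1) / 2 * (b - a) := by
        nlinarith [mul_le_mul_of_nonneg_right hL (sub_nonneg.2 hab)]
    _ = ∑ i ∈ s, (w i * a - (|w i| - w i) / 2 * (b - a)) := by
        rw [Finset.sum_sub_distrib, ← Finset.sum_mul, ← Finset.sum_mul, ← Finset.sum_div,
          Finset.sum_sub_distrib, hw, one_mul]
    _ ≤ ∑ i ∈ s, w i * t i :=
        Finset.sum_le_sum fun i hi ↦ mul_ge_of_mem_interval (ha i hi) (hb i hi) (w i)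


/-- If each `f_i` satisfies the two-sided Bregman bound
(`m_f`-strong convexity and `M_f`-smoothness) and `λ` sums to `1` with
`∑|λ_i| ≤ L`, then the weighted combination `∑ λ_i f_i` satisfies the lower
Bregman bound with modulus `m_f − ((M_f − m_f)/2)(L − 1)`. -/
theorem stmt_11 (d n : ℕ) (f : Fin n → EuclideanSpace ℝ (Fin d) → ℝ)
    (mf Mf : ℝ) (hmf : 0 < mf) (hmM : mf ≤ Mf)
    (hdiff : ∀ i, Differentiable ℝ (f i))
    (hbreg : ∀ i, ∀ x y : EuclideanSpace ℝ (Fin d),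
      mf / 2 * ‖x - y‖ ^ 2 ≤ f i x - f i y - fderiv ℝ (f i) y (x - y) ∧
      f i x - f i y - fderiv ℝ (f i) y (x - y) ≤ Mf / 2 * ‖x - y‖ ^ 2)
    (l : Fin n → ℝ) (hl1 : ∑ i, l i = 1)
    (L : ℝ) (hL : 1 ≤ L) (hlL : ∑ i, |l i| ≤ L)
    (θ θ' : EuclideanSpace ℝ (Fin d)) :
    1 / 2 * (mf - (Mf - mf) / 2 * (L - 1)) * ‖θ - θ'‖ ^ 2 ≤
      (∑ i, l i * f i θ) - (∑ i, l i * f i θ') -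
        (∑ i, l i • fderiv ℝ (f i) θ') (θ - θ') := by
  have key := weighted_sum_ge_of_mem_interval (s := Finset.univ)
    (mul_le_mul_of_nonneg_right (div_le_div_of_nonneg_right hmM zero_le_two)
      (sq_nonneg ‖θ - θ'‖))
    (fun i _ ↦ (hbreg i θ θ').1) (fun i _ ↦ (hbreg i θ θ').2) hl1 hlL
  simp only [mul_sub (l _), Finset.sum_sub_distrib] at key
  simp only [sum_apply, smul_apply, smul_eq_mul]
  linarith
end

section
/- Let Θ ⊂ ℝ^d be a nonempty compact convex set, let Λ ⊂ {λ ∈ ℝ^n : ∑_{i=1}^n λ_i = 1} be a nonempty compact convex set, let ψ : Λ → ℝ be lower semicontinuous, and let f_1,…,f_n : ℝ^d → [0,∞) be differentiable and satisfy, for constants 0 < m_f ≤ M_f and all i, x, y: (m_f/2)‖x−y‖₂² ≤ f_i(x) − f_i(y) − ⟨∇f_i(y), x−y⟩ ≤ (M_f/2)‖x−y‖₂². Assume either (i) M_f > m_f and ‖Λ‖₁ < 1 + 2m_f/(M_f − m_f), or (ii) M_f = m_f. Then any two saddle points of (θ, λ) ↦ ∑_i λ_i f_i(θ) − ψ(λ)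 on Θ × Λ have the same θ-component: if (θ¹, λ¹) and (θ², λ²) each satisfy ∑_i λ_i f_i(θ^ℓ) − ψ(λ) ≤ ∑_i λ^ℓ_i f_i(θ^ℓ) − ψ(λ^ℓ) ≤ ∑_i λ^ℓ_i f_i(θ) − ψ(λ^ℓ) for all θ ∈ Θ and λ ∈ Λ, then θ¹ = θ². -/
/-- Weighted sums of numbers in `[m, M]`, with weights of arbitrary sign. -/
theorem le_sum_mul_of_mem_Icc {ι : Type*} [Fintype ι] (l b : ι → ℝ) {m M : ℝ}
    (hb : ∀ i, m ≤ b i ∧ b i ≤ M) :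
    (m + M) / 2 * ∑ i, l i - (M - m) / 2 * ∑ i, |l i| ≤ ∑ i, l i * b i := by
  rw [Finset.mul_sum, Finset.mul_sum, ← Finset.sum_sub_distrib]
  refine Finset.sum_le_sum fun i _ => ?_
  have h : |b i - (m + M) / 2| ≤ (M - m) / 2 :=
    abs_le.2 ⟨by linarith [(hb i).1], by linarith [(hb i).2]⟩
  have h' := mul_le_mul_of_nonneg_left h (abs_nonneg (l i))
  rw [← abs_mul] at h'
  linarith [neg_abs_le (l i * (b i - (m + M) / 2))]

/-- Two-sided Bregman bounds give two-sided bounds on symmetric second differences. -/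
theorem second_difference_bounds {E : Type*} [NormedAddCommGroup E] [NormedSpace ℝ E]
    {g : E → ℝ} {m M : ℝ}
    (h : ∀ x y : E, m / 2 * ‖x - y‖ ^ 2 ≤ g x - g y - fderiv ℝ g y (x - y) ∧
      g x - g y - fderiv ℝ g y (x - y) ≤ M / 2 * ‖x - y‖ ^ 2) (z e : E) :
    m * ‖e‖ ^ 2 ≤ g (z + e) + g (z - e) - 2 * g z ∧
      g (z + e) + g (z - e) - 2 * g z ≤ M * ‖e‖ ^ 2 := by
  have h₁ := h (z + e) z
  have h₂ := h (z - e) z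
  simp only [add_sub_cancel_left, sub_sub_cancel_left, norm_neg, map_neg] at h₁ h₂
  constructor <;> linarith [h₁.1, h₁.2, h₂.1, h₂.2]


/-- Under the strong-convexity/smoothness Bregman bounds and the
`ℓ¹`-bound `‖Λ‖₁ < 1 + 2m_f/(M_f − m_f)` (or `M_f = m_f`), any two saddle points
of `(θ, λ) ↦ ∑ λ_i f_i(θ) − ψ(λ)` on `Θ × Λ` have the same `θ`-component. -/
theorem stmt_12 (d n : ℕ)
    (Θ : Set (EuclideanSpace ℝ (Fin d)))
    (hΘne : Θ.Nonempty) (hΘc : IsCompact Θ) (hΘconv : Convex ℝ Θ)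
    (Λ : Set (Fin n → ℝ))
    (hΛne : Λ.Nonempty) (hΛc : IsCompact Λ) (hΛconv : Convex ℝ Λ)
    (hΛ1 : ∀ l ∈ Λ, ∑ i, l i = 1)
    (ψ : (Fin n → ℝ) → ℝ) (hψ : LowerSemicontinuousOn ψ Λ)
    (f : Fin n → EuclideanSpace ℝ (Fin d) → ℝ)
    (hf0 : ∀ i x, 0 ≤ f i x)
    (mf Mf : ℝ) (hmf : 0 < mf) (hmM : mf ≤ Mf)
    (hdiff : ∀ i, Differentiable ℝ (f i))
    (hbreg : ∀ i, ∀ x y : EuclideanSpace ℝ (Fin d),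
      mf / 2 * ‖x - y‖ ^ 2 ≤ f i x - f i y - fderiv ℝ (f i) y (x - y) ∧
      f i x - f i y - fderiv ℝ (f i) y (x - y) ≤ Mf / 2 * ‖x - y‖ ^ 2)
    (N : ℝ) (hN : IsGreatest {s : ℝ | ∃ c ∈ Λ, s = ∑ i, |c i|} N)
    (hcase : (mf < Mf ∧ N < 1 + 2 * mf / (Mf - mf)) ∨ Mf = mf)
    (θ1 θ2 : EuclideanSpace ℝ (Fin d)) (l1 l2 : Fin n → ℝ)
    (hθ1 : θ1 ∈ Θ) (hl1 : l1 ∈ Λ) (hθ2 : θ2 ∈ Θ) (hl2 : l2 ∈ Λ)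
    (hsaddle1 : ∀ θ ∈ Θ, ∀ l ∈ Λ,
      ((∑ i, l i * f i θ1) - ψ l ≤ (∑ i, l1 i * f i θ1) - ψ l1) ∧
      ((∑ i, l1 i * f i θ1) - ψ l1 ≤ (∑ i, l1 i * f i θ) - ψ l1))
    (hsaddle2 : ∀ θ ∈ Θ, ∀ l ∈ Λ,
      ((∑ i, l i * f i θ2) - ψ l ≤ (∑ i, l2 i * f i θ2) - ψ l2) ∧
      ((∑ i, l2 i * f i θ2) - ψ l2 ≤ (∑ i, l2 i * f i θ) - ψ l2)) :
    θ1 = θ2 := by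
  set e : EuclideanSpace ℝ (Fin d) := (1 / 2 : ℝ) • (θ1 - θ2) with he
  set z : EuclideanSpace ℝ (Fin d) := (1 / 2 : ℝ) • θ1 + (1 / 2 : ℝ) • θ2 with hz
  have hz₁ : z + e = θ1 := by rw [hz, he]; module
  have hz₂ : z - e = θ2 := by rw [hz, he]; module
  have hzΘ : z ∈ Θ := hΘconv hθ1 hθ2 (by norm_num) (by norm_num) (by norm_num)
  have hsum := le_sum_mul_of_mem_Icc l1
    (fun i => f i θ1 + f i θ2 - 2 * f i z) (m := mf * ‖e‖ ^ 2) (M := Mf * ‖e‖ ^ 2)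
    fun i => by simpa only [hz₁, hz₂] using second_difference_bounds (hbreg i) z e
  have hsplit : ∑ i, l1 i * (f i θ1 + f i θ2 - 2 * f i z) =
      ∑ i, l1 i * f i θ1 + ∑ i, l1 i * f i θ2 - 2 * ∑ i, l1 i * f i z := by
    rw [Finset.mul_sum, ← Finset.sum_add_distrib, ← Finset.sum_sub_distrib]
    exact Finset.sum_congr rfl fun i _ => by ring
  rw [hsplit, hΛ1 l1 hl1] at hsum
  have hmin₁ := (hsaddle1 z hzΘ l1 hl1).2
  have h₁ := (hsaddle1 θ2 hθ2 l2 hl2).1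
  have h₂ := hsaddle2 θ1 hθ1 l1 hl1
  -- `θ1` and `θ2` both minimise the weighted sum with weights `l1`.
  have hle : ∑ i, l1 i * f i θ2 ≤ ∑ i, l1 i * f i θ1 := by linarith [h₂.1, h₂.2]
  have hN1 : ∑ i, |l1 i| ≤ N := hN.2 ⟨l1, hl1, rfl⟩
  have hpos : 0 < (mf + Mf) / 2 - (Mf - mf) / 2 * ∑ i, |l1 i| := by
    rcases hcase with ⟨hlt, hNlt⟩ | rfl
    · have hd : 0 < Mf - mf := sub_pos.2 hlt
      have h := mul_lt_mul_of_pos_left (hN1.trans_lt hNlt) hd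
      rw [mul_add, mul_div_cancel₀ _ hd.ne'] at h
      linarith
    · linarith
  have hsq : ‖e‖ ^ 2 ≤ 0 := by
    by_contra! hlt
    linarith [mul_pos hpos hlt]
  have he0 : e = 0 := norm_eq_zero.1 (pow_eq_zero_iff two_ne_zero |>.1
    (le_antisymm hsq (sq_nonneg _)))
  rw [← hz₁, ← hz₂, he0, add_zero, sub_zero]
end

section
/- Let Θ ⊂ ℝ^d be a nonempty compact convex set, let Λ ⊂ {λ ∈ ℝ^n : ∑_{i=1}^n λ_i = 1} be a nonempty compact convex set, and let f_1,…,f_n : ℝ^d → [0,∞) be differentiable and satisfy, for constants 0 < m_f ≤ M_f and all i, x, y: (m_f/2)‖x−y‖₂² ≤ f_i(x) − f_i(y) − ⟨∇f_i(y), x−y⟩ ≤ (M_f/2)‖x−y‖₂². Assume ‖Λ‖₁ < 1 + 2m_f/M_f. Then there exist a unique θ* ∈ Θ and a nonempty set Λ* ⊆ Λ such that the set of saddle points of (θ, λ) ↦ ∑_{i=1}^n λ_i f_i(θ) on Θ × Λ equals {θ*} × Λ*. -/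
/-- A combination of functions whose Bregman divergences lie between `m / 2 * ‖x - y‖ ^ 2` and
`M / 2 * ‖x - y‖ ^ 2` is strictly convex when the negative weights are small enough. -/
theorem strictConvexOn_sum_mul_of_bregman_bounds {ι E : Type*} [Fintype ι]
    [NormedAddCommGroup E] [NormedSpace ℝ E]
    {f : ι → E → ℝ} {f' : ι → E → E →L[ℝ] ℝ} {m M : ℝ}
    (hf : ∀ i x y, m / 2 * ‖x - y‖ ^ 2 ≤ f i x - f i y - f' i y (x - y) ∧
      f i x - f i y - f' i y (x - y) ≤ M / 2 * ‖x - y‖ ^ 2)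
    {l : ι → ℝ} (hl : (∑ i, |l i|) * (M - m) < (∑ i, l i) * (M + m))
    {s : Set E} (hs : Convex ℝ s) :
    StrictConvexOn ℝ s fun x ↦ ∑ i, l i * f i x := by
  set μ : ℝ := ((∑ i, l i) * (M + m) - (∑ i, |l i|) * (M - m)) / 4 with hμ
  have hμ0 : 0 < μ := by linarith
  have key (x y : E) : (∑ i, l i * f i y) + (∑ i, l i • f' i y) (x - y) + μ * ‖x - y‖ ^ 2 ≤
      ∑ i, l i * f i x := by
    have hsum : μ * ‖x - y‖ ^ 2 =
        ∑ i, (l i * (M + m) - |l i| * (M - m)) / 4 * ‖x - y‖ ^ 2 := by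
      rw [hμ, ← Finset.sum_mul, ← Finset.sum_div, Finset.sum_sub_distrib, Finset.sum_mul,
        Finset.sum_mul]
    rw [hsum, sum_apply, ← Finset.sum_add_distrib, ← Finset.sum_add_distrib]
    refine Finset.sum_le_sum fun i _ ↦ ?_
    obtain ⟨h₁, h₂⟩ := hf i x y
    rw [smul_apply, smul_eq_mul]
    rcases le_total 0 (l i) with h | h
    · rw [abs_of_nonneg h]
      nlinarith [mul_le_mul_of_nonneg_left h₁ h]
    · rw [abs_of_nonpos h]
      nlinarith [mul_le_mul_of_nonpos_left h₂ h]
  refine ⟨hs, fun x _ y _ hxy a b ha hb hab ↦ ?_⟩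
  set z := a • x + b • y with hz
  have hxz : x - z = b • (x - y) := by
    rw [hz, eq_sub_of_add_eq' hab]
    module
  have hyz : y - z = (-a) • (x - y) := by
    rw [hz, eq_sub_of_add_eq hab]
    module
  have h₁ := key x z
  have h₂ := key y z
  rw [hxz, map_smul, norm_smul] at h₁
  rw [hyz, map_smul, norm_smul] at h₂
  simp only [smul_eq_mul, mul_pow, norm_neg, Real.norm_eq_abs, sq_abs] at h₁ h₂ ⊢
  have hpos : 0 < ‖x - y‖ := norm_pos_iff.mpr (sub_ne_zero.mpr hxy)
  have h₃ : 0 < μ * (a * b ^ 2 + b * a ^ 2) * ‖x - y‖ ^ 2 := by positivity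
  have h₄ : a * (∑ i, l i * f i z) + b * (∑ i, l i * f i z) = ∑ i, l i * f i z := by
    rw [← add_mul, hab, one_mul]
  linarith [mul_le_mul_of_nonneg_left h₁ ha.le, mul_le_mul_of_nonneg_left h₂ hb.le]


/-- Under the Bregman bounds and `‖Λ‖₁ < 1 + 2m_f/M_f`, the set of
saddle points of `(θ, λ) ↦ ∑ λ_i f_i(θ)` on `Θ × Λ` equals `{θ*} × Λ*` for a unique
`θ* ∈ Θ` and a nonempty `Λ* ⊆ Λ`. -/
theorem stmt_13 (d n : ℕ)
    (Θ : Set (EuclideanSpace ℝ (Fin d)))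
    (hΘne : Θ.Nonempty) (hΘc : IsCompact Θ) (hΘconv : Convex ℝ Θ)
    (Λ : Set (Fin n → ℝ))
    (hΛne : Λ.Nonempty) (hΛc : IsCompact Λ) (hΛconv : Convex ℝ Λ)
    (hΛ1 : ∀ l ∈ Λ, ∑ i, l i = 1)
    (f : Fin n → EuclideanSpace ℝ (Fin d) → ℝ)
    (hf0 : ∀ i x, 0 ≤ f i x)
    (mf Mf : ℝ) (hmf : 0 < mf) (hmM : mf ≤ Mf)
    (hdiff : ∀ i, Differentiable ℝ (f i))
    (hbreg : ∀ i, ∀ x y : EuclideanSpace ℝ (Fin d),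
      mf / 2 * ‖x - y‖ ^ 2 ≤ f i x - f i y - fderiv ℝ (f i) y (x - y) ∧
      f i x - f i y - fderiv ℝ (f i) y (x - y) ≤ Mf / 2 * ‖x - y‖ ^ 2)
    (N : ℝ) (hN : IsGreatest {s : ℝ | ∃ c ∈ Λ, s = ∑ i, |c i|} N)
    (hnorm : N < 1 + 2 * mf / Mf) :
    ∃ θs ∈ Θ, ∃ Λs : Set (Fin n → ℝ), Λs ⊆ Λ ∧ Λs.Nonempty ∧
      {p : EuclideanSpace ℝ (Fin d) × (Fin n → ℝ) |
        p.1 ∈ Θ ∧ p.2 ∈ Λ ∧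
        (∀ l ∈ Λ, (∑ i, l i * f i p.1) ≤ ∑ i, p.2 i * f i p.1) ∧
        (∀ θ ∈ Θ, (∑ i, p.2 i * f i p.1) ≤ ∑ i, p.2 i * f i θ)} =
      {θs} ×ˢ Λs := by
  have hM : 0 < Mf := hmf.trans_le hmM
  have hstrict (l) (hl : l ∈ Λ) : StrictConvexOn ℝ Θ fun θ ↦ ∑ i, l i * f i θ := by
    refine strictConvexOn_sum_mul_of_bregman_bounds hbreg ?_ hΘconv
    rw [hΛ1 l hl, one_mul]
    have hlN : ∑ i, |l i| ≤ N := hN.2 ⟨l, hl, rfl⟩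
    calc (∑ i, |l i|) * (Mf - mf) ≤ (1 + 2 * mf / Mf) * (Mf - mf) :=
          mul_le_mul_of_nonneg_right (hlN.trans hnorm.le) (sub_nonneg.mpr hmM)
      _ = Mf + mf - 2 * mf ^ 2 / Mf := by field_simp; ring
      _ < Mf + mf := sub_lt_self _ (by positivity)
  obtain ⟨θs, hθs, ls, hls, hsaddle⟩ :
      ∃ a ∈ Θ, ∃ b ∈ Λ, IsSaddlePointOn Θ Λ (fun θ l ↦ ∑ i, l i * f i θ) a b := by
    refine Sion.exists_isSaddlePointOn hΘne hΘconv hΘc (fun l _ ↦ ?_)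
      (fun l hl ↦ (hstrict l hl).convexOn.quasiconvexOn) hΛconv hΛne hΛc (fun θ _ ↦ ?_)
      fun θ _ ↦ ConcaveOn.quasiconcaveOn ⟨hΛconv, fun l _ l' _ a b _ _ _ ↦ le_of_eq ?_⟩
    · have hcont (i) := (hdiff i).continuous
      exact Continuous.lowerSemicontinuous (by fun_prop) |>.lowerSemicontinuousOn _
    · exact Continuous.upperSemicontinuous (by fun_prop) |>.upperSemicontinuousOn _
    · simp only [smul_eq_mul, Finset.mul_sum, ← Finset.sum_add_distrib, Pi.add_apply,
        Pi.smul_apply]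
      exact Finset.sum_congr rfl fun i _ ↦ by ring
  refine ⟨θs, hθs, {l ∈ Λ | IsSaddlePointOn Θ Λ (fun θ l ↦ ∑ i, l i * f i θ) θs l},
    Set.sep_subset _ _, ⟨ls, hls, hsaddle⟩, ?_⟩
  ext ⟨θ, l⟩
  simp only [Set.mem_ofPred_eq, Set.mem_prod, Set.mem_singleton_iff]
  constructor
  · rintro ⟨hθ, hl, hmax, hmin⟩
    have h : IsSaddlePointOn Θ Λ (fun θ l ↦ ∑ i, l i * f i θ) θ l :=
      fun x hx y hy ↦ (hmax y hy).trans (hmin x hx)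
    have h' := hsaddle.swap_left hθ hls h
    exact ⟨(hstrict l hl).eq_of_isMinOn hmin (fun x hx ↦ h' x hx l hl) hθ hθs, hl, h'⟩
  · rintro ⟨rfl, hl, h⟩
    exact ⟨hθs, hl, h θ hθs, fun x hx ↦ h x hx l hl⟩
end

section
/- Let f : ℝ^d → ℝ be differentiable and satisfy, for constants 0 < μ ≤ L and all x, y ∈ ℝ^d: (μ/2)‖x−y‖₂² ≤ f(x) − f(y) − ⟨∇f(y), x−y⟩ ≤ (L/2)‖x−y‖₂². Then for all x, y, z ∈ ℝ^d: f(z) − f(y) + (μ/4)‖y−z‖₂² − L‖z−x‖₂² ≤ ⟨∇f(x), z−y⟩ ≤ f(z) − f(y) + (L − μ/2)‖x−z‖₂² + L‖y−z‖₂². -/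
/-- The squared triangle inequality with constant `2`. -/
theorem norm_sub_sq_le_two_mul_add {E : Type*} [SeminormedAddCommGroup E] (a b c : E) :
    ‖a - c‖ ^ 2 ≤ 2 * ‖a - b‖ ^ 2 + 2 * ‖b - c‖ ^ 2 := by
  have h : ‖a - c‖ ^ 2 ≤ (‖a - b‖ + ‖b - c‖) ^ 2 := by
    gcongr
    exact norm_sub_le_norm_sub_add_norm_sub a b c
  linarith [add_sq_le (a := ‖a - b‖) (b := ‖b - c‖)]


/-- perturbed strong convexity and smoothness: for `μ`-strongly-convex
and `L`-smooth `f` and all `x, y, z`: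
`f(z) − f(y) + (μ/4)‖y−z‖² − L‖z−x‖² ≤ ⟨∇f(x), z−y⟩
  ≤ f(z) − f(y) + (L − μ/2)‖x−z‖² + L‖y−z‖²`. -/
theorem stmt_14 (d : ℕ) (f : EuclideanSpace ℝ (Fin d) → ℝ)
    (μ L : ℝ) (hμ : 0 < μ) (hμL : μ ≤ L)
    (hdiff : Differentiable ℝ f)
    (hbreg : ∀ x y : EuclideanSpace ℝ (Fin d),
      μ / 2 * ‖x - y‖ ^ 2 ≤ f x - f y - fderiv ℝ f y (x - y) ∧
      f x - f y - fderiv ℝ f y (x - y) ≤ L / 2 * ‖x - y‖ ^ 2)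
    (x y z : EuclideanSpace ℝ (Fin d)) :
    f z - f y + μ / 4 * ‖y - z‖ ^ 2 - L * ‖z - x‖ ^ 2 ≤ fderiv ℝ f x (z - y) ∧
    fderiv ℝ f x (z - y) ≤ f z - f y + (L - μ / 2) * ‖x - z‖ ^ 2 + L * ‖y - z‖ ^ 2 := by
  have hsplit : fderiv ℝ f x (z - y) = fderiv ℝ f x (z - x) - fderiv ℝ f x (y - x) := by
    rw [← map_sub, sub_sub_sub_cancel_right]
  obtain ⟨hz_lower, hz_upper⟩ := hbreg z x
  obtain ⟨hy_lower, hy_upper⟩ := hbreg y x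
  rw [hsplit]
  constructor
  · have htri := norm_sub_sq_le_two_mul_add y x z
    rw [norm_sub_rev x z] at htri
    nlinarith [mul_le_mul_of_nonneg_left htri hμ.le,
      mul_le_mul_of_nonneg_right hμL (sq_nonneg ‖z - x‖)]
  · have htri := norm_sub_sq_le_two_mul_add y z x
    rw [norm_sub_rev x z]
    nlinarith [mul_le_mul_of_nonneg_left htri (hμ.le.trans hμL)]
end

section
/- Let γ_0 > 0, τ_0 > 0, and κ > 0 with 1 + κ·τ_0 ≥ (κ·τ_0/3)². Define sequences by γ_{r+1} = γ_r + κ·τ_0·√(γ_0·γ_r), τ_r = τ_0·√(γ_0/γ_r), and σ_r = γ_r·τ_r for all r ≥ 0. Then for all r ≥ 0: (i) γ_r ≥ ((r/3)·κ·τ_0·√γ_0)²; (ii) σ_r ≥ τ_0·√(γ_0·γ_r) ≥ (r/3)·κ·τ_0²·γ_0; and (iii) τ_r·σ_r = τ_0²·γ_0. In particular γ_r grows at least quadratically in r, σ_r at least linearly in r, and τ_r/σ_r = 1/γ_r decays at rate O(1/r²). -/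
/-- If `s (r + 1) ^ 2 = s r ^ 2 + 3 * b * s r` for all `r` and `b ≤ s 1`, then the sequence `s`
grows at least linearly with slope `b`. -/
theorem natCast_mul_le_of_sq_succ_eq {s : ℕ → ℝ} {b : ℝ} (hs : ∀ r, 0 ≤ s r) (hb : 0 ≤ b)
    (h1 : b ≤ s 1) (hsucc : ∀ r, s (r + 1) ^ 2 = s r ^ 2 + 3 * b * s r) (r : ℕ) :
    r * b ≤ s r := by
  induction r with
  | zero => simpa using hs 0
  | succ r ih =>
    rcases Nat.eq_zero_or_pos r with rfl | hr
    · simpa using h1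
    · have hr : (1 : ℝ) ≤ r := by exact_mod_cast hr
      refine (pow_le_pow_iff_left₀ (by positivity) (hs _) two_ne_zero).1 ?_
      rw [hsucc]
      push_cast
      have hsq : (r * b) ^ 2 ≤ s r ^ 2 := pow_le_pow_left₀ (by positivity) ih 2
      nlinarith [mul_le_mul_of_nonneg_left ih hb, mul_nonneg (sub_nonneg.2 hr) (sq_nonneg b)]

/-- For the sequences `γ_{r+1} = γ_r + κτ_0√(γ_0γ_r)`,
`τ_r = τ_0√(γ_0/γ_r)`, `σ_r = γ_rτ_r` with `γ_0, τ_0, κ > 0` and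
`1 + κτ_0 ≥ (κτ_0/3)²`: (i) `γ_r ≥ ((r/3)κτ_0√γ_0)²`;
(ii) `σ_r ≥ τ_0√(γ_0γ_r) ≥ (r/3)κτ_0²γ_0`; (iii) `τ_rσ_r = τ_0²γ_0`. -/
theorem stmt_16 (κ : ℝ) (hκ : 0 < κ) (γ τ σ : ℕ → ℝ)
    (hγ0 : 0 < γ 0) (hτ0 : 0 < τ 0)
    (hinit : (κ * τ 0 / 3) ^ 2 ≤ 1 + κ * τ 0)
    (hγ : ∀ r, γ (r + 1) = γ r + κ * τ 0 * Real.sqrt (γ 0 * γ r))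
    (hτ : ∀ r, τ r = τ 0 * Real.sqrt (γ 0 / γ r))
    (hσ : ∀ r, σ r = γ r * τ r) :
    ∀ r : ℕ, ((r : ℝ) / 3 * (κ * τ 0 * Real.sqrt (γ 0))) ^ 2 ≤ γ r ∧
      τ 0 * Real.sqrt (γ 0 * γ r) ≤ σ r ∧
      (r : ℝ) / 3 * (κ * τ 0 ^ 2 * γ 0) ≤ τ 0 * Real.sqrt (γ 0 * γ r) ∧
      τ r * σ r = τ 0 ^ 2 * γ 0 := by
  have hpos : ∀ r, 0 < γ r := by
    intro r
    induction r with
    | zero => exact hγ0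
    | succ r ih => rw [hγ]; positivity
  have hs : ∀ r, √(γ r) ^ 2 = γ r := fun r => Real.sq_sqrt (hpos r).le
  have hsucc : ∀ r, √(γ (r + 1)) ^ 2 =
      √(γ r) ^ 2 + 3 * (κ * τ 0 * √(γ 0) / 3) * √(γ r) := by
    intro r
    rw [hs, hs, hγ, Real.sqrt_mul hγ0.le]
    ring
  have h1 : κ * τ 0 * √(γ 0) / 3 ≤ √(γ 1) := by
    refine Real.le_sqrt_of_sq_le ?_
    have h := hsucc 0
    rw [zero_add, hs 1] at h
    rw [h]
    nlinarith [mul_le_mul_of_nonneg_right hinit (sq_nonneg √(γ 0))]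
  intro r
  have hlin : r * (κ * τ 0 * √(γ 0) / 3) ≤ √(γ r) :=
    natCast_mul_le_of_sq_succ_eq (fun r => Real.sqrt_nonneg _) (by positivity) h1 hsucc r
  have hσr : σ r = τ 0 * √(γ 0 * γ r) := by
    have hne : √(γ r) ≠ 0 := (Real.sqrt_pos.2 (hpos r)).ne'
    rw [hσ, hτ, Real.sqrt_div hγ0.le, Real.sqrt_mul hγ0.le]
    nth_rw 1 [← hs r]
    field_simp
  refine ⟨?_, hσr.ge, ?_, ?_⟩
  · calc ((r : ℝ) / 3 * (κ * τ 0 * √(γ 0))) ^ 2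
        = (r * (κ * τ 0 * √(γ 0) / 3)) ^ 2 := by ring
      _ ≤ √(γ r) ^ 2 := pow_le_pow_left₀ (by positivity) hlin 2
      _ = γ r := hs r
  · calc (r : ℝ) / 3 * (κ * τ 0 ^ 2 * γ 0)
        = τ 0 * √(γ 0) * (r * (κ * τ 0 * √(γ 0) / 3)) := by
          nth_rw 1 [← hs 0]
          ring
      _ ≤ τ 0 * √(γ 0) * √(γ r) := mul_le_mul_of_nonneg_left hlin (by positivity)
      _ = τ 0 * √(γ 0 * γ r) := by rw [Real.sqrt_mul hγ0.le, mul_assoc]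
  · have hne : γ r ≠ 0 := (hpos r).ne'
    rw [hσ, hτ]
    calc τ 0 * √(γ 0 / γ r) * (γ r * (τ 0 * √(γ 0 / γ r)))
        = τ 0 ^ 2 * γ r * √(γ 0 / γ r) ^ 2 := by ring
      _ = τ 0 ^ 2 * γ 0 := by
          rw [Real.sq_sqrt (div_nonneg hγ0.le (hpos r).le)]
          field_simp
end

section
/- Let c ≥ 1 and let {ϖ_r}_{r≥0} be a sequence with 0 ≤ ϖ_r ≤ 1 and ϖ_r ≤ c·ϖ_{r+1} for all r ≥ 0. Define S_r = ∑_{i=0}^{r−1} ϖ_i · ∏_{j=i+1}^{r} (1 − ϖ_j) for r ≥ 1 (and S_0 = 0). Then S_r ≤ c + 1 for all r ≥ 0. -/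
theorem sum_mul_prod_Icc_succ (ϖ : ℕ → ℝ) (r : ℕ) :
    ∑ i ∈ Finset.range (r + 1), ϖ i * ∏ j ∈ Finset.Icc (i + 1) (r + 1), (1 - ϖ j) =
      (1 - ϖ (r + 1)) *
        (∑ i ∈ Finset.range r, ϖ i * ∏ j ∈ Finset.Icc (i + 1) r, (1 - ϖ j) + ϖ r) := by
  have h : ∀ i ∈ Finset.range r, ϖ i * ∏ j ∈ Finset.Icc (i + 1) (r + 1), (1 - ϖ j) =
      (1 - ϖ (r + 1)) * (ϖ i * ∏ j ∈ Finset.Icc (i + 1) r, (1 - ϖ j)) := by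
    intro i hi
    rw [Finset.prod_Icc_succ_top (by have := Finset.mem_range.mp hi; omega)]
    ring
  rw [Finset.sum_range_succ, Finset.sum_congr rfl h, ← Finset.mul_sum, Finset.Icc_self,
    Finset.prod_singleton]
  ring

theorem sum_mul_prod_Icc_le (c : ℝ) (hc : 0 ≤ c) (ϖ : ℕ → ℝ) (h1 : ∀ r, ϖ r ≤ 1)
    (hrec : ∀ r, ϖ r ≤ c * ϖ (r + 1)) (r : ℕ) :
    ∑ i ∈ Finset.range r, ϖ i * ∏ j ∈ Finset.Icc (i + 1) r, (1 - ϖ j) ≤ c := by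
  induction r with
  | zero => simpa using hc
  | succ r ih =>
    rw [sum_mul_prod_Icc_succ]
    calc _ ≤ (1 - ϖ (r + 1)) * (c + c * ϖ (r + 1)) :=
          mul_le_mul_of_nonneg_left (add_le_add ih (hrec r)) (sub_nonneg.mpr (h1 _))
      _ ≤ c := by nlinarith [mul_nonneg hc (sq_nonneg (ϖ (r + 1)))]


/-- If `c ≥ 1`, `0 ≤ ϖ_r ≤ 1`, and `ϖ_r ≤ c·ϖ_{r+1}` for all `r`,
then `S_r = ∑_{i=0}^{r−1} ϖ_i ∏_{j=i+1}^{r} (1 − ϖ_j) ≤ c + 1` for all `r`. -/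
theorem stmt_17 (c : ℝ) (hc : 1 ≤ c) (ϖ : ℕ → ℝ)
    (h0 : ∀ r, 0 ≤ ϖ r) (h1 : ∀ r, ϖ r ≤ 1)
    (hrec : ∀ r, ϖ r ≤ c * ϖ (r + 1)) :
    ∀ r : ℕ, ∑ i ∈ Finset.range r, ϖ i * ∏ j ∈ Finset.Icc (i + 1) r, (1 - ϖ j) ≤ c + 1 := by
  intro r
  have := sum_mul_prod_Icc_le c (by linarith) ϖ h1 hrec r
  linarith
end

section
/- Let Θ be a nonempty set, n ≥ 1, A, B ⊆ Δ^{n−1} nonempty, f_1,…,f_n : Θ → [0,∞), and φ ∈ [0,1). Define the integrated ambiguity set Λ_φ(A,B) = {(a − φ·b)/(1 − φ) : a ∈ A, b ∈ B} ⊂ ℝ^n. Then: (i) every λ ∈ Λ_φ(A,B) satisfies ∑_{i=1}^n λ_i = 1; and (ii) for every θ ∈ Θ, sup_{λ ∈ Λ_φ(A,B)} ∑_{i=1}^n λ_i f_i(θ) = (1/(1−φ))·( sup_{a∈A} ∑_{i=1}^n a_i f_i(θ) − φ·inf_{b∈B} ∑_{i=1}^n b_i f_i(θ) ). Consequently, minimizing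 θ ↦ sup_{λ∈Λ_φ(A,B)} ∑_i λ_i f_i(θ) over Θ is equivalent (up to the positive factor 1/(1−φ)) to minimizing the relative fairness discrepancy θ ↦ sup_{a∈A} ∑_i a_i f_i(θ) − φ·inf_{b∈B} ∑_i b_i f_i(θ). -/
theorem isLUB_sub_mul_div_one_sub {X Y : Set ℝ} {u v φ : ℝ} (hX : IsLUB X u) (hY : IsGLB Y v)
    (hYne : Y.Nonempty) (hφ0 : 0 ≤ φ) (hφ1 : φ < 1) :
    IsLUB {s | ∃ x ∈ X, ∃ y ∈ Y, s = (x - φ * y) / (1 - φ)} ((u - φ * v) / (1 - φ)) := by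
  have hpos : 0 < 1 - φ := sub_pos.2 hφ1
  constructor
  · rintro _ ⟨x, hx, y, hy, rfl⟩
    have hxu := hX.1 hx
    have hvy := mul_le_mul_of_nonneg_left (hY.1 hy) hφ0
    exact div_le_div_of_nonneg_right (by linarith) hpos.le
  · intro w hw
    rw [div_le_iff₀ hpos]
    have hu : ∀ y ∈ Y, u ≤ w * (1 - φ) + φ * y := fun y hy => hX.2 fun x hx => by
      have := (div_le_iff₀ hpos).1 (hw ⟨x, hx, y, hy, rfl⟩)
      linarith
    rcases hφ0.eq_or_lt with rfl | hφ
    · obtain ⟨y, hy⟩ := hYne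
      have := hu y hy
      linarith
    · have hv : (u - w * (1 - φ)) / φ ≤ v := hY.2 fun y hy => by
        rw [div_le_iff₀ hφ]
        linarith [hu y hy]
      rw [div_le_iff₀ hφ] at hv
      linarith

theorem sum_mul_le_sum_of_sum_eq_one {ι : Type*} [Fintype ι] {a g : ι → ℝ} (ha : ∀ i, 0 ≤ a i)
    (hsum : ∑ i, a i = 1) (hg : ∀ i, 0 ≤ g i) : ∑ i, a i * g i ≤ ∑ i, g i :=
  Finset.sum_le_sum fun i _ => mul_le_of_le_one_left (hg i) <|
    hsum ▸ Finset.single_le_sum (fun j _ => ha j) (Finset.mem_univ i)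

theorem sum_sub_mul_div_one_sub_mul {ι : Type*} [Fintype ι] (a b g : ι → ℝ) (φ : ℝ) :
    ∑ i, (a i - φ * b i) / (1 - φ) * g i =
      (∑ i, a i * g i - φ * ∑ i, b i * g i) / (1 - φ) := by
  rw [Finset.mul_sum, ← Finset.sum_sub_distrib, Finset.sum_div]
  exact Finset.sum_congr rfl fun i _ => by ring


/-- For the integrated ambiguity set
`Λ_φ(A,B) = {(a − φb)/(1 − φ) : a ∈ A, b ∈ B}` with `A, B ⊆ Δ^{n−1}` nonempty and
`φ ∈ [0,1)`: (i) every `λ ∈ Λ_φ(A,B)` sums to `1`; (ii) for every `θ`,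
`sup_{λ∈Λ_φ(A,B)} ∑ λ_i f_i(θ)
  = (1/(1−φ))(sup_{a∈A} ∑ a_i f_i(θ) − φ·inf_{b∈B} ∑ b_i f_i(θ))`. -/
theorem stmt_19 {T : Type*} [Nonempty T] (n : ℕ) (hn : 1 ≤ n)
    (A B : Set (Fin n → ℝ)) (hAne : A.Nonempty) (hBne : B.Nonempty)
    (hA : ∀ a ∈ A, (∀ i, 0 ≤ a i) ∧ ∑ i, a i = 1)
    (hB : ∀ b ∈ B, (∀ i, 0 ≤ b i) ∧ ∑ i, b i = 1)
    (f : Fin n → T → ℝ) (hf0 : ∀ i t, 0 ≤ f i t)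
    (φ : ℝ) (hφ0 : 0 ≤ φ) (hφ1 : φ < 1) :
    (∀ l ∈ {l : Fin n → ℝ | ∃ a ∈ A, ∃ b ∈ B, l = fun i => (a i - φ * b i) / (1 - φ)},
      ∑ i, l i = 1) ∧
    (∀ t : T,
      sSup {s : ℝ | ∃ l ∈ {l : Fin n → ℝ |
              ∃ a ∈ A, ∃ b ∈ B, l = fun i => (a i - φ * b i) / (1 - φ)},
            s = ∑ i, l i * f i t} =
        (1 / (1 - φ)) *
          (sSup {s : ℝ | ∃ a ∈ A, s = ∑ i, a i * f i t} -
            φ * sInf {s : ℝ | ∃ b ∈ B, s = ∑ i, b i * f i t})) := by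
  constructor
  · rintro _ ⟨a, ha, b, hb, rfl⟩
    have h := sum_sub_mul_div_one_sub_mul a b 1 φ
    simp only [Pi.one_apply, mul_one, (hA a ha).2, (hB b hb).2] at h
    rw [h, div_self (sub_pos.2 hφ1).ne']
  · intro t
    set X := {s : ℝ | ∃ a ∈ A, s = ∑ i, a i * f i t}
    set Y := {s : ℝ | ∃ b ∈ B, s = ∑ i, b i * f i t}
    have hXne : X.Nonempty := hAne.elim fun a ha => ⟨_, a, ha, rfl⟩
    have hYne : Y.Nonempty := hBne.elim fun b hb => ⟨_, b, hb, rfl⟩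
    have hXbdd : BddAbove X := by
      refine ⟨∑ i, f i t, ?_⟩
      rintro _ ⟨a, ha, rfl⟩
      exact sum_mul_le_sum_of_sum_eq_one (hA a ha).1 (hA a ha).2 fun i => hf0 i t
    have hYbdd : BddBelow Y := by
      refine ⟨0, ?_⟩
      rintro _ ⟨b, hb, rfl⟩
      exact Finset.sum_nonneg fun i _ => mul_nonneg ((hB b hb).1 i) (hf0 i t)
    have hlub := isLUB_sub_mul_div_one_sub (isLUB_csSup hXne hXbdd) (isGLB_csInf hYne hYbdd)
      hYne hφ0 hφ1
    rw [one_div_mul_eq_div, ← hlub.csSup_eq (hXne.elim fun x hx => hYne.elim fun y hy =>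
      ⟨_, x, hx, y, hy, rfl⟩)]
    congr 1
    ext s
    constructor
    · rintro ⟨_, ⟨a, ha, b, hb, rfl⟩, rfl⟩
      exact ⟨_, ⟨a, ha, rfl⟩, _, ⟨b, hb, rfl⟩, sum_sub_mul_div_one_sub_mul a b (f · t) φ⟩
    · rintro ⟨_, ⟨a, ha, rfl⟩, _, ⟨b, hb, rfl⟩, rfl⟩
      exact ⟨_, ⟨a, ha, b, hb, rfl⟩, (sum_sub_mul_div_one_sub_mul a b (f · t) φ).symm⟩
end
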